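/- Let n ≥ 1 be a natural number, let λ, δ be real numbers, set β = (n+1)(1−δ), and for natural numbers m ≤ k define C_m^k = (1/m!) · (k−m+(n+1)λ)_m / (2(k−m)+β+m−1)_m and C̃_m^k = ((−1)^m/m!) · (k−m+(n+1)λ)_m / (2(k−m)+β)_m. Let k ≥ 1 and 1 ≤ p ≤ k, and assume β + t ≠ 0 for every integer t with 2(k−p) ≤ t ≤ 2k−2. Then Σ_{m=0}^{p} C̃_m^k · C_{p−m}^{k−m} = 0. -/

import Mathlib

/-- The Pochhammer symbol `(a)_m = a (a+1) ⋯ (a+m-1)` for a real number `a`. -/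
noncomputable def poch (a : ℝ) (m : ℕ) : ℝ := ∏ j ∈ Finset.range m, (a + j)

/-- The coefficients `C_m^k` of the projectively equivariant quantization map
(Corollary 3.2), with `β = (n+1)(1-δ)`. -/
noncomputable def quantCoeff (n : ℕ) (lam δ : ℝ) (m k : ℕ) : ℝ :=
  (1 / (Nat.factorial m : ℝ)) *
    poch (((k : ℝ) - (m : ℝ)) + ((n : ℝ) + 1) * lam) m /
    poch (2 * ((k : ℝ) - (m : ℝ)) + ((n : ℝ) + 1) * (1 - δ) + (m : ℝ) - 1) m

/-- The coefficients `C̃_m^k` of the projectively equivariant symbol map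
(Theorem 3.5), with `β = (n+1)(1-δ)`. -/
noncomputable def symbCoeff (n : ℕ) (lam δ : ℝ) (m k : ℕ) : ℝ :=
  ((-1 : ℝ) ^ m / (Nat.factorial m : ℝ)) *
    poch (((k : ℝ) - (m : ℝ)) + ((n : ℝ) + 1) * lam) m /
    poch (2 * ((k : ℝ) - (m : ℝ)) + ((n : ℝ) + 1) * (1 - δ)) m

theorem poch_succ' (a : ℝ) (m : ℕ) : poch a (m + 1) = poch a m * (a + m) := by
  simp [poch, Finset.prod_range_succ]

theorem poch_add' (a : ℝ) (m l : ℕ) : poch a (m + l) = poch a m * poch (a + m) l := by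
  simp only [poch, Finset.prod_range_add]
  congr 1
  apply Finset.prod_congr rfl
  intro i _
  push_cast
  ring

theorem poch_ne' (a : ℝ) (m : ℕ) (h : ∀ i : ℕ, i < m → a + i ≠ 0) : poch a m ≠ 0 := by
  unfold poch
  rw [Finset.prod_ne_zero_iff]
  intro i hi
  exact h i (Finset.mem_range.mp hi)

theorem partial_sum (b : ℝ) (q : ℕ) (hb : ∀ t : ℕ, t ≤ 2 * q → b + t ≠ 0) (J : ℕ) (hJ : J ≤ q) :
    ∑ j ∈ Finset.range (J + 1), (-1 : ℝ) ^ j * ((q + 1).choose j : ℝ) /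
      (poch (b + j - 1) j * poch (b + 2 * j) (q + 1 - j))
    = (-1 : ℝ) ^ J * (q.choose J : ℝ) / poch (b + J) (q + 1) := by
  induction J with
  | zero => simp [poch]
  | succ J ih =>
    rw [Finset.sum_range_succ, ih (by omega)]
    obtain ⟨r, rfl⟩ : ∃ r, q = J + 1 + r := ⟨q - (J + 1), by omega⟩
    have e1 : J + 1 + r + 1 - (J + 1) = r + 1 := by omega
    rw [e1]
    have c1 : b + ((J + 1 : ℕ) : ℝ) - 1 = b + J := by push_cast; ring
    have c2 : b + 2 * ((J + 1 : ℕ) : ℝ) = b + 2 * J + 2 := by push_cast; ring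
    have c3 : b + ((J + 1 : ℕ) : ℝ) = b + J + 1 := by push_cast; ring
    rw [c1, c2, c3]
    -- the full product and its factorizations
    have f1 : poch (b + J) (J + 1 + 1 + (r + 1))
        = poch (b + J) (J + 1) * (b + 2 * J + 1) * poch (b + 2 * J + 2) (r + 1) := by
      rw [poch_add', poch_succ' _ (J + 1)]
      congr 2
      · push_cast; ring
      · push_cast; ring
    have f2 : poch (b + J) (J + 1 + 1 + (r + 1))
        = poch (b + J) (J + 1 + r + 1) * (b + J + (J + 1 + r + 1)) := by
      rw [show J + 1 + 1 + (r + 1) = (J + 1 + r + 1) + 1 by ring, poch_succ']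
      push_cast; ring
    have f3 : poch (b + J) (J + 1 + 1 + (r + 1))
        = (b + J) * poch (b + J + 1) (J + 1 + r + 1) := by
      rw [show J + 1 + 1 + (r + 1) = 1 + (J + 1 + r + 1) by ring, poch_add']
      simp [poch]
    have hP : poch (b + J) (J + 1 + 1 + (r + 1)) ≠ 0 := by
      apply poch_ne'
      intro i hi
      have := hb (J + i) (by omega)
      push_cast at this
      rwa [add_assoc]
    have n1 := hP
    rw [f1] at n1
    have n2 := hP
    rw [f2] at n2
    have n3 := hP
    rw [f3] at n3
    have g1 : 1 / (poch (b + J) (J + 1) * poch (b + 2 * J + 2) (r + 1))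
        = (b + 2 * J + 1) / poch (b + J) (J + 1 + 1 + (r + 1)) := by
      rw [div_eq_div_iff (by intro h; apply n1; linear_combination (b + 2 * J + 1) * h) hP, f1]
      ring
    have g2 : 1 / poch (b + J) (J + 1 + r + 1)
        = (b + J + (J + 1 + r + 1)) / poch (b + J) (J + 1 + 1 + (r + 1)) := by
      rw [div_eq_div_iff (left_ne_zero_of_mul n2) hP, f2]
      ring
    have g3 : 1 / poch (b + J + 1) (J + 1 + r + 1)
        = (b + J) / poch (b + J) (J + 1 + 1 + (r + 1)) := by
      rw [div_eq_div_iff (right_ne_zero_of_mul n3) hP, f3]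
      ring
    have k1 : ((J + 1 + r + 1).choose (J + 1) : ℝ)
        = (J + 1 + r).choose J + (J + 1 + r).choose (J + 1) := by
      exact_mod_cast Nat.choose_succ_succ (J + 1 + r) J
    have k2 : ((J + 1 + r + 1 : ℝ)) * (J + 1 + r).choose J
        = (J + 1 + r + 1).choose (J + 1) * (J + 1) := by
      exact_mod_cast Nat.add_one_mul_choose_eq (J + 1 + r) J
    rw [div_eq_mul_one_div, g2, div_eq_mul_one_div _ (_ * _), g1, div_eq_mul_one_div _ (poch (b + J + 1) _), g3]
    simp only [← mul_div_assoc]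
    rw [← add_div]
    congr 1
    rw [pow_succ]
    linear_combination (-1 : ℝ) ^ J * k2 - (-1 : ℝ) ^ J * (b + J) * k1

theorem full_sum (b : ℝ) (q : ℕ) (hb : ∀ t : ℕ, t ≤ 2 * q → b + t ≠ 0) :
    ∑ j ∈ Finset.range (q + 1 + 1), (-1 : ℝ) ^ j * ((q + 1).choose j : ℝ) /
      (poch (b + j - 1) j * poch (b + 2 * j) (q + 1 - j)) = 0 := by
  rw [Finset.sum_range_succ, partial_sum b q hb q le_rfl]
  have c1 : b + ((q + 1 : ℕ) : ℝ) - 1 = b + q := by push_cast; ring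
  have c2 : poch (b + 2 * ((q + 1 : ℕ) : ℝ)) (q + 1 - (q + 1)) = 1 := by simp [poch]
  rw [c1, c2]
  simp only [Nat.choose_self, pow_succ]
  ring

/-- Coefficientwise statement that `Q_{λ,μ} ∘ σ_{λ,μ} = id`: the convolution of
the quantization coefficients with the symbol coefficients vanishes in each
positive degree `p ≥ 1`. -/
theorem quantization_comp_symbol_coeff_vanishes
    (n : ℕ) (hn : 1 ≤ n) (lam δ : ℝ) (k p : ℕ)
    (hk : 1 ≤ k) (hp : 1 ≤ p) (hpk : p ≤ k)
    (hβ : ∀ t : ℕ, 2 * (k - p) ≤ t → t ≤ 2 * k - 2 →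
      ((n : ℝ) + 1) * (1 - δ) + (t : ℝ) ≠ 0) :
    ∑ m ∈ Finset.range (p + 1),
      symbCoeff n lam δ m k * quantCoeff n lam δ (p - m) (k - m) = 0 := by
  obtain ⟨q, rfl⟩ : ∃ q, p = q + 1 := ⟨p - 1, by omega⟩
  obtain ⟨s, rfl⟩ : ∃ s, k = s + (q + 1) := ⟨k - (q + 1), by omega⟩
  have hb : ∀ t : ℕ, t ≤ 2 * q → (2 * (s : ℝ) + ((n : ℝ) + 1) * (1 - δ)) + t ≠ 0 := by
    intro t ht
    have := hβ (2 * s + t) (by omega) (by omega)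
    push_cast at this
    intro h
    apply this
    linear_combination h
  have key := full_sum _ q hb
  rw [← Finset.sum_flip]
  rw [← mul_zero (poch ((s : ℝ) + ((n : ℝ) + 1) * lam) (q + 1) * (-1) ^ (q + 1)
    / (Nat.factorial (q + 1) : ℝ)), ← key, Finset.mul_sum]
  apply Finset.sum_congr rfl
  intro j hj
  obtain ⟨r, hr⟩ : ∃ r, q + 1 = j + r := ⟨q + 1 - j, by have := Finset.mem_range.mp hj; omega⟩
  rw [hr]
  have e1 : j + r - j = r := by omega
  have e2 : j + r - r = j := by omega
  have e3 : s + (j + r) - r = s + j := by omega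
  rw [e1, e2, e3]
  unfold symbCoeff quantCoeff
  have a1 : ((s + (j + r) : ℕ) : ℝ) - (r : ℝ) = s + j := by push_cast; ring
  have a2 : ((s + j : ℕ) : ℝ) - (j : ℝ) = s := by push_cast; ring
  rw [a1, a2, poch_add']
  have b1 : (s : ℝ) + j + ((n : ℝ) + 1) * lam = s + ((n : ℝ) + 1) * lam + j := by ring
  have b2 : 2 * ((s : ℝ) + j) + ((n : ℝ) + 1) * (1 - δ)
    = 2 * (s : ℝ) + ((n : ℝ) + 1) * (1 - δ) + 2 * j := by ring
  rw [b1, b2]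
  have hc : ((j + r).choose j : ℝ) / (Nat.factorial (j + r) : ℝ)
      = 1 / (Nat.factorial r : ℝ) * (1 / (Nat.factorial j : ℝ)) := by
    have h := Nat.add_choose_mul_factorial_mul_factorial j r
    rw [← Nat.choose_symm_add] at h
    have h' : ((j + r).choose j : ℝ) * (Nat.factorial j : ℝ) * (Nat.factorial r : ℝ)
      = (Nat.factorial (j + r) : ℝ) := by exact_mod_cast h
    have h1 : (Nat.factorial j : ℝ) ≠ 0 := by positivity
    have h2 : (Nat.factorial r : ℝ) ≠ 0 := by positivity
    have h3 : (Nat.factorial (j + r) : ℝ) ≠ 0 := by positivity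
    field_simp
    linear_combination h'
  have hs : (-1 : ℝ) ^ (j + r) * (-1) ^ j = (-1) ^ r := by
    rw [pow_add, mul_right_comm, ← mul_pow]
    simp
  generalize poch ((s : ℝ) + ((n : ℝ) + 1) * lam) j = P1
  generalize poch ((s : ℝ) + ((n : ℝ) + 1) * lam + j) r = P2
  generalize poch (2 * (s : ℝ) + ((n : ℝ) + 1) * (1 - δ) + 2 * j) r = D1
  generalize poch (2 * (s : ℝ) + ((n : ℝ) + 1) * (1 - δ) + j - 1) j = D2
  calc _ = P1 * P2 * (-1) ^ r * (1 / (Nat.factorial r : ℝ) * (1 / (Nat.factorial j : ℝ)))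
          / (D2 * D1) := by ring
    _ = _ := by
      rw [← hc, ← hs]
      ring
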